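/- Let f : [0,1]^d → ℝ be smooth on simplices, x ∈ (0,1)^d an interior point with coincidence partition d(x) = {P_1,…,P_k}, J = {j_1,…,j_k} a set with j_i ∈ P_i, H := {1,…,d} \ J, and V_H ⊆ {0,1}^d the set of vectors supported on H. Then for every v ∈ {0,1}^d there exist ε > 0, an open neighbourhood U ⊆ (0,1)^d of x, and C^∞ functions (F_{v_H})_{v_H ∈ V_H} on U such that Δ_h^v f(x') = ∑_{v_H ∈ V_H} Δ_h^{v+v_H} F_{v_H}(x') for all x' ∈ U with d(x') = d(x) and all 0 < h < ε. -/

import Mathlib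

open MeasureTheory Filter Set

namespace Paper

variable {d : ℕ}

/-- The closed unit cube `[0,1]^d`. -/
def cubeIcc (d : ℕ) : Set (Fin d → ℝ) := Set.Icc 0 1

/-- The half-open cube `[0,1)^d`. -/
def cubeIco (d : ℕ) : Set (Fin d → ℝ) := Set.univ.pi fun _ => Set.Ico (0:ℝ) 1

/-- The open cube `(0,1)^d`. -/
def cubeIoo (d : ℕ) : Set (Fin d → ℝ) := Set.univ.pi fun _ => Set.Ioo (0:ℝ) 1

/-- The sign `(−1)^{⟨v,w⟩}` for `v, w ∈ {0,1}^d`. -/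
def sgn (v w : Fin d → Bool) : ℝ :=
  (-1) ^ (Finset.univ.filter fun i => v i = true ∧ w i = true).card

/-- `|v|`, the number of nonzero entries of `v ∈ {0,1}^d`. -/
def wt (v : Fin d → Bool) : ℕ := (Finset.univ.filter fun i => v i = true).card

/-- The vector `h^w = h·((−1)^{w_1},…,(−1)^{w_d})`. -/
def shiftVec (h : ℝ) (w : Fin d → Bool) : Fin d → ℝ := fun i => if w i then -h else h

/-- The discrete Fourier difference `Δ_h^v f (x) = 2^{-d} ∑_w (−1)^{⟨v,w⟩} f(x + h^w)`. -/
noncomputable def dfourier (f : (Fin d → ℝ) → ℝ) (v : Fin d → Bool) (h : ℝ)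
    (x : Fin d → ℝ) : ℝ :=
  (1 / 2 ^ d) * ∑ w : Fin d → Bool, sgn v w * f (x + shiftVec h w)

/-- The partial derivative in direction `i`. -/
noncomputable def pderivI (i : Fin d) (f : (Fin d → ℝ) → ℝ) : (Fin d → ℝ) → ℝ :=
  fun x => fderiv ℝ f x (Pi.single i 1)

/-- The mixed partial derivative `D^v f = (∂/∂x_1)^{v_1} ⋯ (∂/∂x_d)^{v_d} f`. -/
noncomputable def Dmixed (v : Fin d → Bool) (f : (Fin d → ℝ) → ℝ) : (Fin d → ℝ) → ℝ :=
  (List.finRange d).foldr (fun i g => cond (v i) (pderivI i g) g) f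

/-- The Kuhn simplex `S_σ = {x ∈ [0,1]^d : x_{σ(1)} ≤ … ≤ x_{σ(d)}}`. -/
def KuhnSimplex (σ : Equiv.Perm (Fin d)) : Set (Fin d → ℝ) :=
  {x | x ∈ cubeIcc d ∧ ∀ i j : Fin d, i ≤ j → x (σ i) ≤ x (σ j)}

/-- A continuous function on the cube is smooth on simplices if its restriction to each
Kuhn simplex extends to a `C^∞` function on an open neighbourhood of the simplex. -/
def SmoothOnSimplices (f : (Fin d → ℝ) → ℝ) : Prop :=
  ContinuousOn f (cubeIcc d) ∧
  ∀ σ : Equiv.Perm (Fin d), ∃ (U : Set (Fin d → ℝ)) (g : (Fin d → ℝ) → ℝ),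
    IsOpen U ∧ KuhnSimplex σ ⊆ U ∧ ContDiffOn ℝ (⊤ : ℕ∞) g U ∧ Set.EqOn f g (KuhnSimplex σ)

/-- The centre `x̃^{(n)}` of the lattice cell of side `1/n` containing `x`. -/
noncomputable def latticeCenter (n : ℕ) (x : Fin d → ℝ) : Fin d → ℝ :=
  fun i => (⌊(n : ℝ) * x i⌋ : ℝ) / n + 1 / (2 * n)

/-- The `n`-th lattice approximation `Δ̃_n^v f (x) = Δ_{1/(2n)}^v f (x̃^{(n)})`. -/
noncomputable def latticeDelta (n : ℕ) (f : (Fin d → ℝ) → ℝ) (v : Fin d → Bool)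
    (x : Fin d → ℝ) : ℝ :=
  dfourier f v (1 / (2 * n)) (latticeCenter n x)

/-- `f` has generalised differential `L` at `x` to `v` in degree `α`. -/
def HasGenDeriv (f : (Fin d → ℝ) → ℝ) (v : Fin d → Bool) (α : ℕ)
    (x : Fin d → ℝ) (L : ℝ) : Prop :=
  Tendsto (fun h : ℝ => (1 / h ^ α) * dfourier f v h x) (nhdsWithin 0 (Set.Ioi 0)) (nhds L)

/-- The generalised differential `D_α^v f(x)` (the value of the limit when it exists). -/
noncomputable def genDeriv (f : (Fin d → ℝ) → ℝ) (v : Fin d → Bool) (α : ℕ)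
    (x : Fin d → ℝ) : ℝ :=
  limUnder (nhdsWithin 0 (Set.Ioi 0)) fun h : ℝ => (1 / h ^ α) * dfourier f v h x

/-- `x` has coincidence partition given by the fibres of the surjection `p`,
i.e. `d(x) = 𝒫` where `𝒫` is the partition of `{1,…,d}` into the fibres of `p`. -/
def CoincWith (x : Fin d → ℝ) {k : ℕ} (p : Fin d → Fin k) : Prop :=
  ∀ i j, x i = x j ↔ p i = p j

/-- The generalised diagonal `𝒟_𝒫 = {x ∈ (0,1)^d : d(x) = 𝒫}`. -/
def diagP {k : ℕ} (p : Fin d → Fin k) : Set (Fin d → ℝ) :=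
  {x | x ∈ cubeIoo d ∧ CoincWith x p}

/-- `α(𝒫,v)`: the number of blocks of `𝒫` containing an index `a` with `v_a = 1`. -/
def alphaP {k : ℕ} (p : Fin d → Fin k) (v : Fin d → Bool) : ℕ :=
  ((Finset.univ.filter fun i => v i = true).image p).card

/-- One-coordinate sign. -/
def sg (a b : Bool) : ℝ := if a = true ∧ b = true then -1 else 1

theorem sgn_eq_prod (v w : Fin d → Bool) : sgn v w = ∏ i, sg (v i) (w i) := by
  unfold sgn sg
  rw [Finset.prod_ite]
  simp

theorem sgn_xor (v u w : Fin d → Bool) :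
    sgn (fun i => xor (v i) (u i)) w = sgn v w * sgn u w := by
  simp only [sgn_eq_prod, ← Finset.prod_mul_distrib]
  refine Finset.prod_congr rfl fun i _ => ?_
  cases v i <;> cases u i <;> cases w i <;> simp [sg]

theorem filter_eq_pi (J : Finset (Fin d)) :
    Finset.univ.filter (fun w : Fin d → Bool => ∀ j ∈ J, w j = false)
      = Fintype.piFinset (fun i => if i ∈ J then ({false} : Finset Bool) else Finset.univ) := by
  ext w
  simp only [Finset.mem_filter, Finset.mem_univ, true_and, Fintype.mem_piFinset]
  refine forall_congr' fun i => ?_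
  by_cases h : i ∈ J <;> simp [h]

/-- Normalising constant `2^{|H|}`. -/
def KJ (J : Finset (Fin d)) : ℝ := ∏ i : Fin d, if i ∈ J then 1 else 2

theorem KJ_ne (J : Finset (Fin d)) : KJ J ≠ 0 := by
  unfold KJ
  refine Finset.prod_ne_zero_iff.2 fun i _ => ?_
  split_ifs <;> norm_num

theorem orth (J : Finset (Fin d)) (w a : Fin d → Bool) :
    ∑ u ∈ Finset.univ.filter (fun w : Fin d → Bool => ∀ j ∈ J, w j = false),
      sgn u w * sgn u a = if ∀ i, i ∉ J → a i = w i then KJ J else 0 := by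
  rw [filter_eq_pi]
  simp only [sgn_eq_prod, ← Finset.prod_mul_distrib]
  rw [← Finset.prod_univ_sum (fun i => if i ∈ J then ({false} : Finset Bool) else Finset.univ)
    (fun i b => sg b (w i) * sg b (a i))]
  split_ifs with h
  · unfold KJ
    refine Finset.prod_congr rfl fun i _ => ?_
    by_cases hi : i ∈ J
    · simp [hi, sg]
    · rw [h i hi]
      cases w i <;> simp [hi, sg] <;> norm_num
  · push Not at h
    obtain ⟨i, hi, hne⟩ := h
    refine Finset.prod_eq_zero (Finset.mem_univ i) ?_
    revert hne
    cases w i <;> cases a i <;> simp [hi, sg]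

/-- Fourier inversion on `V_H`. -/
theorem inversion (J : Finset (Fin d)) (w : Fin d → Bool) (g : (Fin d → Bool) → ℝ) :
    ∑ u ∈ Finset.univ.filter (fun w : Fin d → Bool => ∀ j ∈ J, w j = false),
      sgn u w * ((KJ J)⁻¹ * ∑ a ∈ Finset.univ.filter
        (fun w : Fin d → Bool => ∀ j ∈ J, w j = false), sgn u a * g a)
      = g (fun i => if i ∈ J then false else w i) := by
  have h1 : ∀ u : Fin d → Bool, sgn u w * ((KJ J)⁻¹ * ∑ a ∈ Finset.univ.filter
        (fun w : Fin d → Bool => ∀ j ∈ J, w j = false), sgn u a * g a)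
      = ∑ a ∈ Finset.univ.filter (fun w : Fin d → Bool => ∀ j ∈ J, w j = false),
        (sgn u w * sgn u a) * ((KJ J)⁻¹ * g a) := by
    intro u
    rw [Finset.mul_sum, Finset.mul_sum]
    refine Finset.sum_congr rfl fun a _ => ?_
    ring
  simp only [h1]
  rw [Finset.sum_comm]
  simp only [← Finset.sum_mul, orth]
  rw [Finset.sum_eq_single (fun i => if i ∈ J then false else w i)]
  · rw [if_pos (by intro i hi; simp [hi]), mul_inv_cancel_left₀ (KJ_ne J)]
  · intro a ha hne
    rw [if_neg, zero_mul]
    intro h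
    apply hne
    funext i
    by_cases hi : i ∈ J
    · simp [hi, (Finset.mem_filter.1 ha).2 i hi]
    · simp [hi, h i hi]
  · intro h
    exact absurd (Finset.mem_filter.2 ⟨Finset.mem_univ _, by intro j hj; simp [hj]⟩) h

/-- Tie-breaking key. -/
def tie (J : Finset (Fin d)) (a : Fin d → Bool) (i : Fin d) : ℕ :=
  if i ∈ J then 1 else if a i then 0 else 2

/-- The permutation sorting by `x`, ties broken by `tie`. -/
noncomputable def perm (x : Fin d → ℝ) (J : Finset (Fin d)) (a : Fin d → Bool) :
    Equiv.Perm (Fin d) :=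
  Tuple.sort (fun i => (toLex (x i, tie J a i) : ℝ ×ₗ ℕ))

theorem perm_spec (x : Fin d → ℝ) (J : Finset (Fin d)) (a : Fin d → Bool) {i j : Fin d}
    (hij : i ≤ j) : x (perm x J a i) < x (perm x J a j) ∨
      (x (perm x J a i) = x (perm x J a j) ∧ tie J a (perm x J a i) ≤ tie J a (perm x J a j)) := by
  have := Tuple.monotone_sort (fun i => (toLex (x i, tie J a i) : ℝ ×ₗ ℕ)) hij
  rw [Function.comp, Function.comp, Prod.Lex.toLex_le_toLex] at this
  exact this

theorem mem_kuhn (x : Fin d → ℝ) (J : Finset (Fin d)) (hJ : ∀ i : Fin d, ∃! j, j ∈ J ∧ x j = x i)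
    (a w : Fin d → Bool) (haw : ∀ i, i ∉ J → a i = w i) (δ : ℝ)
    (h0 : ∀ i, 2 * δ < x i ∧ x i < 1 - 2 * δ)
    (h1 : ∀ i j, x i < x j → x i + 4 * δ < x j)
    (x' : Fin d → ℝ) (hx' : ∀ i, |x' i - x i| < δ) (hc : ∀ i j, x' i = x' j ↔ x i = x j)
    (h : ℝ) (hh : 0 < h) (hhδ : h < δ) :
    x' + shiftVec h w ∈ KuhnSimplex (perm x J a) := by
  have hs : ∀ i, -h ≤ shiftVec h w i ∧ shiftVec h w i ≤ h := by
    intro i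
    unfold shiftVec
    split_ifs <;> constructor <;> linarith
  refine ⟨⟨fun i => ?_, fun i => ?_⟩, fun i j hij => ?_⟩
  · have := abs_lt.1 (hx' i)
    have := hs i
    have := h0 i
    simp only [Pi.zero_apply, Pi.add_apply]
    linarith
  · have := abs_lt.1 (hx' i)
    have := hs i
    have := h0 i
    simp only [Pi.one_apply, Pi.add_apply]
    linarith
  · have key := perm_spec x J a hij
    generalize perm x J a i = p at key ⊢
    generalize perm x J a j = q at key ⊢
    simp only [Pi.add_apply]
    rcases key with hlt | ⟨heq, htie⟩
    · have := h1 p q hlt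
      have := abs_lt.1 (hx' p)
      have := abs_lt.1 (hx' q)
      have := hs p
      have := hs q
      linarith
    · rw [(hc p q).2 heq]
      refine add_le_add le_rfl ?_
      by_cases hp : p ∈ J <;> by_cases hq : q ∈ J
      · have : p = q := (hJ q).unique ⟨hp, heq⟩ ⟨hq, rfl⟩
        rw [this]
      · have e := haw q hq
        have := (hs p).2
        cases hwq : w q
        · simpa [shiftVec, hwq] using this
        · simp [tie, hp, hq, e, hwq] at htie
      · have e := haw p hp
        have := (hs q).1
        cases hwp : w p
        · simp [tie, hp, hq, e, hwp] at htie
        · simpa [shiftVec, hwp] using this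
      · have e := haw p hp
        have e' := haw q hq
        cases hwp : w p <;> cases hwq : w q <;>
          simp [tie, hp, hq, e, e', hwp, hwq, shiftVec] at htie ⊢
        linarith

theorem self_mem_kuhn (x : Fin d → ℝ) (hx : x ∈ cubeIoo d) (J : Finset (Fin d))
    (a : Fin d → Bool) : x ∈ KuhnSimplex (perm x J a) := by
  have hx2 : ∀ i, 0 < x i ∧ x i < 1 := fun i => hx i (Set.mem_univ i)
  refine ⟨⟨fun i => (hx2 i).1.le, fun i => (hx2 i).2.le⟩, fun i j hij => ?_⟩
  rcases perm_spec x J a hij with h | h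
  · exact h.le
  · exact h.1.le

theorem exists_delta (x : Fin d → ℝ) (hx : x ∈ cubeIoo d) : ∃ δ > (0 : ℝ),
    (∀ i, 2 * δ < x i ∧ x i < 1 - 2 * δ) ∧ ∀ i j, x i < x j → x i + 4 * δ < x j := by
  have hx2 : ∀ i, 0 < x i ∧ x i < 1 := fun i => hx i (Set.mem_univ i)
  have small : ∀ c : ℝ, 0 < c → ∀ᶠ δ in nhdsWithin (0 : ℝ) (Set.Ioi 0), δ < c := fun c hc =>
    mem_nhdsWithin_of_mem_nhds (Iio_mem_nhds hc)
  have A : ∀ᶠ δ in nhdsWithin (0 : ℝ) (Set.Ioi 0), ∀ i, 2 * δ < x i ∧ x i < 1 - 2 * δ := by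
    refine Filter.eventually_all.2 fun i => ?_
    filter_upwards [small (x i / 2) (by linarith [(hx2 i).1]),
      small ((1 - x i) / 2) (by linarith [(hx2 i).2])] with δ h1 h2
    constructor <;> linarith
  have B : ∀ᶠ δ in nhdsWithin (0 : ℝ) (Set.Ioi 0), ∀ i j, x i < x j → x i + 4 * δ < x j := by
    refine Filter.eventually_all.2 fun i => Filter.eventually_all.2 fun j => ?_
    by_cases h : x i < x j
    · filter_upwards [small ((x j - x i) / 4) (by linarith)] with δ h1 _
      linarith
    · exact Filter.Eventually.of_forall fun δ h' => absurd h' h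
  have C : ∀ᶠ δ in nhdsWithin (0 : ℝ) (Set.Ioi 0), 0 < δ := self_mem_nhdsWithin
  obtain ⟨δ, h1, h2, h3⟩ := (C.and (A.and B)).exists
  exact ⟨δ, h1, h2, h3⟩

/-- With `f`, `x`, `J`, `H`, `V_H` as in Statement 1: for every
`v ∈ {0,1}^d` there are `ε > 0`, an open neighbourhood `U ⊆ (0,1)^d` of `x` and `C^∞`
functions `(F_{v_H})_{v_H ∈ V_H}` on `U` such that
`Δ_h^v f(x') = ∑_{v_H ∈ V_H} Δ_h^{v+v_H} F_{v_H}(x')` for all `x' ∈ U` with `d(x') = d(x)`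
and all `0 < h < ε`. -/
theorem statement2 {d : ℕ} (f : (Fin d → ℝ) → ℝ) (hf : SmoothOnSimplices f)
    (x : Fin d → ℝ) (hx : x ∈ cubeIoo d)
    (J : Finset (Fin d)) (hJ : ∀ i : Fin d, ∃! j, j ∈ J ∧ x j = x i)
    (v : Fin d → Bool) :
    ∃ ε > (0 : ℝ), ∃ U : Set (Fin d → ℝ), IsOpen U ∧ x ∈ U ∧ U ⊆ cubeIoo d ∧
      ∃ F : (Fin d → Bool) → (Fin d → ℝ) → ℝ,
        (∀ w ∈ Finset.univ.filter (fun w : Fin d → Bool => ∀ j ∈ J, w j = false),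
          ContDiffOn ℝ (⊤ : ℕ∞) (F w) U) ∧
        ∀ x' ∈ U, (∀ i j, x' i = x' j ↔ x i = x j) →
          ∀ h : ℝ, 0 < h → h < ε →
            dfourier f v h x'
              = ∑ w ∈ Finset.univ.filter (fun w : Fin d → Bool => ∀ j ∈ J, w j = false),
                dfourier (F w) (fun i => xor (v i) (w i)) h x' := by
  obtain ⟨δ, hδ, h0, h1⟩ := exists_delta x hx
  choose W g hWo hWs hg hfg using hf.2
  have hopen : IsOpen (cubeIoo d) := isOpen_set_pi Set.finite_univ fun _ _ => isOpen_Ioo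
  refine ⟨δ, hδ, (cubeIoo d ∩ Metric.ball x δ) ∩ ⋂ a : Fin d → Bool, W (perm x J a),
    (hopen.inter Metric.isOpen_ball).inter (isOpen_iInter_of_finite fun a => hWo _),
    ⟨⟨hx, Metric.mem_ball_self hδ⟩, Set.mem_iInter.2 fun a => hWs _ (self_mem_kuhn x hx J a)⟩,
    fun y hy => hy.1.1,
    fun u y => (KJ J)⁻¹ * ∑ a ∈ Finset.univ.filter
        (fun w : Fin d → Bool => ∀ j ∈ J, w j = false), sgn u a * g (perm x J a) y, ?_, ?_⟩
  · intro u _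
    refine contDiffOn_const.mul (ContDiffOn.sum fun a _ => contDiffOn_const.mul ?_)
    exact (hg (perm x J a)).mono fun y hy => Set.mem_iInter.1 hy.2 a
  · intro x' hx' hc h hh hhδ
    have hclose : ∀ i, |x' i - x i| < δ := fun i => by
      have := (dist_pi_lt_iff hδ).1 (Metric.mem_ball.1 hx'.1.2) i
      rwa [Real.dist_eq] at this
    unfold dfourier
    rw [← Finset.mul_sum, Finset.sum_comm]
    congr 1
    refine Finset.sum_congr rfl fun w _ => ?_
    simp only [sgn_xor, mul_assoc]
    rw [← Finset.mul_sum]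
    congr 1
    rw [inversion J w (fun a => g (perm x J a) (x' + shiftVec h w))]
    exact hfg _ (mem_kuhn x J hJ _ w (by intro i hi; simp [hi]) δ h0 h1 x' hclose hc h hh hhδ)

end Paper
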